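/- Let G be a non-elementary δ-hyperbolic group and let A = a₁^G ∪ a₂^G ∪ ⋯ ∪ a_s^G be a finite union of conjugacy classes of elements a₁,…,a_s ∈ G. If the subset A is infinite, then A is not quasiconvex. -/

import Mathlib

open Pointwise

section WordMetric

variable {G : Type*} [Group G]

/-- The word length of `g` with respect to a generating set `S`: the length of a shortest
word in the letters of `S` representing `g`. -/
noncomputable def wordLength (S : Set G) (g : G) : ℕ :=
  sInf {n | ∃ l : List G, (∀ s ∈ l, s ∈ S) ∧ l.prod = g ∧ l.length = n}

/-- The word metric `d(x, y) = |x⁻¹ y|` associated with the generating set `S`,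
viewed as a real number. -/
noncomputable def wdist (S : Set G) (x y : G) : ℝ :=
  (wordLength S (x⁻¹ * y) : ℝ)

/-- The Gromov product `(x|y)_w = ½ (d(x,w) + d(y,w) − d(x,y))`. -/
noncomputable def gromovProd (S : Set G) (x y w : G) : ℝ :=
  (wdist S x w + wdist S y w - wdist S x y) / 2

/-- `z` lies between `x` and `y`: `d(x,z) + d(z,y) = d(x,y)`. -/
def LiesBetween (S : Set G) (x z y : G) : Prop :=
  wdist S x z + wdist S z y = wdist S x y

/-- `G` is `δ`-hyperbolic with respect to the word metric of `S`:
(i) the Gromov products satisfy the `δ`-inequality; (ii) triangles are `δ`-thin;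
(iii) triangles are `δ`-slim. -/
def IsHyperbolicWith (S : Set G) (δ : ℝ) : Prop :=
  (∀ x y z w : G,
      gromovProd S x y w ≥ min (gromovProd S x z w) (gromovProd S y z w) - δ) ∧
  (∀ x y z p q : G, LiesBetween S x p y → LiesBetween S x q z →
      wdist S x p = wdist S x q → wdist S x p ≤ gromovProd S y z x →
      wdist S p q ≤ δ) ∧
  (∀ x y z p : G, LiesBetween S x p y →
      ∃ q : G, (LiesBetween S x q z ∨ LiesBetween S z q y) ∧ wdist S p q ≤ δ)

/-- A subset `Q ⊆ G` is `ε`-quasiconvex: every point between two points of `Q`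
is at distance at most `ε` from `Q`. -/
def IsEpsQuasiconvex (S : Set G) (ε : ℝ) (Q : Set G) : Prop :=
  ∀ x ∈ Q, ∀ y ∈ Q, ∀ z : G, LiesBetween S x z y → ∃ q ∈ Q, wdist S z q ≤ ε

/-- A subset `Q ⊆ G` is quasiconvex if it is `ε`-quasiconvex for some `ε ≥ 0`. -/
def IsQuasiconvex (S : Set G) (Q : Set G) : Prop :=
  ∃ ε : ℝ, 0 ≤ ε ∧ IsEpsQuasiconvex S ε Q

/-- For subsets `B A` of a group `G`, `Prec B A` means `B ⪯ A`: there exist finitely many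
elements `x₁, …, xₙ ∈ G` with `B ⊆ A x₁ ∪ ⋯ ∪ A xₙ`. -/
def Prec (B A : Set G) : Prop :=
  ∃ T : Finset G, B ⊆ A * (T : Set G)

/-- `A ≈ B` : `A ⪯ B` and `B ⪯ A`. -/
def Approx (A B : Set G) : Prop :=
  Prec A B ∧ Prec B A

/-- A subset `A` is quasidense if `G ⪯ A`. -/
def Quasidense (A : Set G) : Prop :=
  Prec (Set.univ : Set G) A

/-- The conjugate subgroup `gHg⁻¹`. -/
def conjSubgroup (g : G) (H : Subgroup G) : Subgroup G :=
  H.map (MulAut.conj g).toMonoidHom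

/-- `H^G = {g h g⁻¹ : h ∈ H, g ∈ G}`, the union of all conjugates of `H`. -/
def conjUnion (H : Subgroup G) : Set G :=
  {x | ∃ g : G, ∃ h ∈ H, x = g * h * g⁻¹}

/-- The quasiconvex product `f₀ G₁ f₁ G₂ ⋯ f_{n−1} G_n f_n` determined by the subgroups
`H 0, …, H (n-1)` and the elements `f 0, …, f n`. -/
def quasiconvexProduct (n : ℕ) (f : Fin (n + 1) → G) (H : Fin n → Subgroup G) : Set G :=
  {x | ∃ g : Fin n → G, (∀ i, g i ∈ H i) ∧
        x = f 0 * (List.ofFn fun i : Fin n => g i * f i.succ).prod}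

end WordMetric

section HyperbolicLength

variable {G : Type*} [Group G]

/-- An integer-valued length function on a group, invariant under inversion and subadditive,
with finite balls, whose left-invariant metric is geodesic (in the discrete sense) and satisfies
the four-point hyperbolicity condition with constant `D`. -/
structure HyperbolicLength (L : G → ℕ) (D : ℕ) : Prop where
  one : L 1 = 0
  inv : ∀ g, L g⁻¹ = L g
  mul : ∀ g h, L (g * h) ≤ L g + L h
  ball_finite : ∀ n, {g | L g ≤ n}.Finite
  exists_geodesic : ∀ x, ∃ γ : ℕ → G, γ 0 = 1 ∧ γ (L x) = x ∧
    ∀ i j, i ≤ j → j ≤ L x → L ((γ i)⁻¹ * γ j) + i = j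
  four_point : ∀ x y z w, L (x⁻¹ * y) + L (z⁻¹ * w) ≤ L (x⁻¹ * z) + L (y⁻¹ * w) + D ∨
    L (x⁻¹ * y) + L (z⁻¹ * w) ≤ L (x⁻¹ * w) + L (y⁻¹ * z) + D

/-- The left-invariant metric of a length function. -/
def lenDist (L : G → ℕ) (x y : G) : ℕ := L (x⁻¹ * y)

/-- `γ` restricted to `{0, …, n}` is a geodesic starting at `1`. -/
def IsGeodesicFromOne (L : G → ℕ) (γ : ℕ → G) (n : ℕ) : Prop :=
  γ 0 = 1 ∧ ∀ i j, i ≤ j → j ≤ n → lenDist L (γ i) (γ j) + i = j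

namespace HyperbolicLength

variable {L : G → ℕ} {D : ℕ}

lemma dist_comm (H : HyperbolicLength L D) (x y : G) : lenDist L x y = lenDist L y x := by
  unfold lenDist
  rw [← H.inv, mul_inv_rev, inv_inv]

lemma dist_triangle (H : HyperbolicLength L D) (x y z : G) :
    lenDist L x z ≤ lenDist L x y + lenDist L y z := by
  unfold lenDist
  simpa [mul_assoc] using H.mul (x⁻¹ * y) (y⁻¹ * z)

lemma dist_mul_left (L : G → ℕ) (g x y : G) : lenDist L (g * x) (g * y) = lenDist L x y := by
  simp [lenDist, mul_assoc]

lemma dist_one_left (L : G → ℕ) (x : G) : lenDist L 1 x = L x := by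
  simp [lenDist]

lemma four_point_dist (H : HyperbolicLength L D) (x y z w : G) :
    lenDist L x y + lenDist L z w ≤ lenDist L x z + lenDist L y w + D ∨
    lenDist L x y + lenDist L z w ≤ lenDist L x w + lenDist L y z + D :=
  H.four_point x y z w

/-- An almost-midpoint of `1` and a conjugate `x` of a short element is moved
a bounded distance by `x`. -/
lemma dist_conj_midpoint (H : HyperbolicLength L D) {h b x y : G} {C e : ℕ}
    (hx : x = h * b * h⁻¹) (hb : L b ≤ C) (hy : 2 * L y ≤ L x + e)
    (hyx : 2 * lenDist L y x ≤ L x + e) :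
    lenDist L y (x * y) ≤ 3 * C + 2 * D + e := by
  have e1 : lenDist L h (x * h) ≤ C := by
    rw [lenDist, hx]; simpa [mul_assoc] using hb
  have e2 : lenDist L x (x * h) = L h := by
    simp [lenDist]
  have e3 : lenDist L x (x * y) = L y := by
    simp [lenDist]
  have e4 := dist_mul_left L x y h
  have t1 := H.dist_triangle x (x * h) h
  have t2 := H.dist_triangle (x * y) (x * h) h
  have t3 := H.dist_triangle x h (x * h)
  have c1 := H.dist_comm h (x * h)
  have c2 := H.dist_comm x h
  have c3 := H.dist_comm (x * y) x
  have c4 := H.dist_comm y 1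
  have c5 := H.dist_comm x y
  have c6 := H.dist_comm h 1
  have o1 := dist_one_left L y
  have o2 := dist_one_left L x
  have o3 := dist_one_left L h
  have f1 := H.four_point_dist y h 1 x
  have f2 := H.four_point_dist y (x * y) h x
  omega

section Geodesic

variable {γ : ℕ → G} {n : ℕ}

lemma _root_.IsGeodesicFromOne.mono (hγ : IsGeodesicFromOne L γ n) {m : ℕ} (hm : m ≤ n) :
    IsGeodesicFromOne L γ m :=
  ⟨hγ.1, fun i j hij hj => hγ.2 i j hij (hj.trans hm)⟩

lemma _root_.IsGeodesicFromOne.length_eq (hγ : IsGeodesicFromOne L γ n) {i : ℕ} (hi : i ≤ n) :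
    L (γ i) = i := by
  have := hγ.2 0 i (Nat.zero_le _) hi
  rw [hγ.1, dist_one_left] at this
  simpa using this

/-- If `v` moves both ends of a geodesic by a bounded distance, it moves every point of it
by a bounded distance. -/
lemma dist_geodesic_translate (H : HyperbolicLength L D) (hγ : IsGeodesicFromOne L γ n) {v : G}
    {C : ℕ} (hv : L v ≤ C) (hvn : lenDist L (γ n) (v * γ n) ≤ C) {i : ℕ} (hi : i ≤ n) :
    lenDist L (γ i) (v * γ i) ≤ C + D := by
  have g1 := hγ.2 i n hi le_rfl
  have l1 := hγ.length_eq hi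
  have l2 := hγ.length_eq (le_refl n)
  have m1 := dist_mul_left L v (γ i) (γ n)
  have t1 := H.dist_triangle (v * γ i) (v * γ n) (γ n)
  have t2 := H.mul v (γ i)
  have c1 := H.dist_comm (γ n) (v * γ n)
  have c2 := H.dist_comm (γ i) 1
  have c3 := H.dist_comm (v * γ i) 1
  have o1 := dist_one_left L (γ i)
  have o2 := dist_one_left L (γ n)
  have o3 := dist_one_left L (v * γ i)
  have f := H.four_point_dist (γ i) (v * γ i) 1 (γ n)
  omega

/-- An interior point of a geodesic is moved by `v` close to the same geodesic. -/
lemma dist_translate_to_geodesic (H : HyperbolicLength L D) (hγ : IsGeodesicFromOne L γ n) {v : G}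
    {C : ℕ} (hv : L v ≤ C) (hvn : lenDist L (γ n) (v * γ n) ≤ C) {i : ℕ} (hi : C + D < i)
    (hin : i + C + D < n) :
    lenDist L (v * γ i) (γ (L (v * γ i))) ≤ 3 * D := by
  have hin' : i ≤ n := by omega
  have g1 := hγ.2 i n hin' le_rfl
  have l1 := hγ.length_eq hin'
  have l2 := hγ.length_eq (le_refl n)
  have m1 := dist_mul_left L v (γ i) (γ n)
  have m2 : lenDist L v (v * γ n) = L (γ n) := by simp [lenDist]
  have m3 : lenDist L v (v * γ i) = L (γ i) := by simp [lenDist]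
  have t2 := H.dist_triangle v 1 (v * γ i)
  have t3 := H.dist_triangle (v * γ i) (γ n) (v * γ n)
  have t4 := H.mul v (γ i)
  have c1 := H.dist_comm (γ n) (v * γ n)
  have c2 := H.dist_comm (v * γ i) 1
  have c3 := H.dist_comm v 1
  have c4 := H.dist_comm (v * γ n) 1
  have c5 := H.dist_comm (v * γ i) (v * γ n)
  have c6 := H.dist_comm (v * γ i) (γ n)
  have o1 := dist_one_left L (γ i)
  have o2 := dist_one_left L (γ n)
  have o3 := dist_one_left L (v * γ i)
  have o4 := dist_one_left L v
  have f1 := H.four_point_dist v (v * γ n) 1 (v * γ i)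
  have f2 := H.four_point_dist (v * γ n) 1 (γ n) (v * γ i)
  have hle : L (v * γ i) ≤ n := by omega
  have g2 := hγ.2 (L (v * γ i)) n hle le_rfl
  have l3 := hγ.length_eq hle
  have c7 := H.dist_comm (γ (L (v * γ i))) 1
  have o5 := dist_one_left L (γ (L (v * γ i)))
  have f3 := H.four_point_dist (v * γ i) (γ (L (v * γ i))) 1 (γ n)
  omega

lemma length_translate_geodesic_le (H : HyperbolicLength L D) (hγ : IsGeodesicFromOne L γ n)
    {v : G} {C : ℕ} (hv : L v ≤ C) {i j : ℕ} (hi : C + D < i) (hij : i ≤ j) (hj : j ≤ n) :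
    L (v * γ i) + j ≤ L (v * γ j) + i + D := by
  have g1 := hγ.2 i j hij hj
  have l1 := hγ.length_eq hj
  have l2 := hγ.length_eq (hij.trans hj)
  have m1 := dist_mul_left L v (γ i) (γ j)
  have m2 : lenDist L v (v * γ j) = L (γ j) := by simp [lenDist]
  have m3 : lenDist L v (v * γ i) = L (γ i) := by simp [lenDist]
  have t1 := H.dist_triangle v 1 (v * γ i)
  have c1 := H.dist_comm v 1
  have c2 := H.dist_comm (v * γ i) v
  have o1 := dist_one_left L (v * γ i)
  have o2 := dist_one_left L (v * γ j)
  have o3 := dist_one_left L v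
  have f := H.four_point_dist 1 (v * γ i) v (v * γ j)
  omega

/-- If `v` almost stabilizes a long geodesic, then at an interior point `z` the displacement of
`v ^ 2` is almost twice that of `v`. -/
lemma two_mul_displacement_le (H : HyperbolicLength L D) (hγ : IsGeodesicFromOne L γ n) {v : G}
    {C : ℕ} (hv : L v ≤ C) (hvn : lenDist L (γ n) (v * γ n) ≤ C) {m : ℕ}
    (hm : 2 * C + D < m) (hmn : m + 2 * C + D < n) :
    2 * lenDist L (γ m) (v * γ m) ≤ lenDist L (γ m) (v * (v * γ m)) + 13 * D := by
  have hmn' : m ≤ n := by omega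
  have b1 := H.dist_translate_to_geodesic hγ hv hvn (i := m) (by omega) (by omega)
  have l1 := hγ.length_eq hmn'
  have t1 := H.mul v (γ m)
  have t2 := H.mul v⁻¹ (v * γ m)
  have i1 := H.inv v
  rw [inv_mul_cancel_left] at t2
  obtain ⟨a, ha⟩ : ∃ a, a = L (v * γ m) := ⟨_, rfl⟩
  rw [← ha] at b1 t1 t2
  obtain ⟨i, hi⟩ : ∃ i, i + a = 2 * m := ⟨2 * m - a, by omega⟩
  have b2 := H.dist_translate_to_geodesic hγ hv hvn (i := i) (by omega) (by omega)
  obtain ⟨r, hr⟩ : ∃ r, r = L (v * γ i) := ⟨_, rfl⟩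
  rw [← hr] at b2
  have hin : i ≤ n := by omega
  have han : a ≤ n := by omega
  have m1 := dist_mul_left L v (γ i) (γ m)
  have s1 := H.dist_triangle 1 (v * γ i) (v * γ m)
  have s2 := H.dist_triangle 1 (v * γ m) (v * γ i)
  have c1 := H.dist_comm (v * γ i) (v * γ m)
  have o1 := dist_one_left L (v * γ i)
  have o2 := dist_one_left L (v * γ m)
  have key : m ≤ r + D ∧ r ≤ m + D ∧ lenDist L (γ i) (γ a) = (a - i) + (i - a) ∧
      lenDist L (γ m) (γ a) = (a - m) + (m - a) := by
    rcases le_total i m with him | him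
    · have g1 := hγ.2 i m him hmn'
      have g2 := hγ.2 i a (by omega) han
      have g3 := hγ.2 m a (by omega) han
      have q := H.length_translate_geodesic_le hγ hv (i := i) (j := m) (by omega) him hmn'
      omega
    · have g1 := hγ.2 m i him hin
      have g2 := hγ.2 a i (by omega) hin
      have g3 := hγ.2 a m (by omega) hmn'
      have c2 := H.dist_comm (γ i) (γ a)
      have c3 := H.dist_comm (γ m) (γ a)
      have c4 := H.dist_comm (γ m) (γ i)
      have q := H.length_translate_geodesic_le hγ hv (i := m) (j := i) (by omega) him hin
      omega
  obtain ⟨k1, k2, k3, k4⟩ := key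
  have k5 : lenDist L (γ r) (γ m) ≤ D := by
    rcases le_total r m with hrm | hrm
    · have := hγ.2 r m hrm hmn'
      omega
    · have := hγ.2 m r hrm (by omega)
      have := H.dist_comm (γ r) (γ m)
      omega
  have u1 := H.dist_triangle (v * γ i) (γ r) (γ m)
  have u2 := H.dist_triangle (γ i) (v * γ m) (γ a)
  have m2 := dist_mul_left L v (γ i) (v * γ m)
  have u3 := H.dist_triangle (v * γ i) (γ m) (v * (v * γ m))
  have u4 := H.dist_triangle (γ m) (γ a) (v * γ m)
  have c5 := H.dist_comm (γ a) (v * γ m)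
  omega

end Geodesic

/-- If `L (u ^ 2)` is almost `2 * L u`, then the lengths of the powers of `u` grow linearly. -/
lemma mul_le_length_pow (H : HyperbolicLength L D) {u : G} {c t : ℕ}
    (hu : 2 * L u ≤ L (u ^ 2) + c) (hc : c + D + t + 1 ≤ L u) (k : ℕ) :
    k * (t + 1) ≤ L (u ^ k) := by
  have step : ∀ k, L (u ^ k) + (t + 1) ≤ L (u ^ (k + 1)) ∧
      L (u ^ k) + L u ≤ L (u ^ (k + 1)) + c + D := by
    intro k
    induction k with
    | zero => simp [H.one]; omega
    | succ k ih =>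
      have f := H.four_point_dist 1 (u ^ (k + 1)) (u ^ k) (u ^ (k + 1 + 1))
      have e1 : lenDist L (u ^ k) (u ^ (k + 1 + 1)) = L (u ^ 2) := by
        rw [lenDist, pow_succ, pow_succ, mul_assoc, inv_mul_cancel_left, pow_two]
      have e2 : lenDist L (u ^ (k + 1)) (u ^ (k + 1 + 1)) = L u := by
        rw [lenDist, pow_succ u (k + 1), inv_mul_cancel_left]
      have e3 : lenDist L (u ^ (k + 1)) (u ^ k) = L u := by
        rw [H.dist_comm, lenDist, pow_succ, inv_mul_cancel_left]
      simp only [dist_one_left, e1, e2, e3] at f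
      omega
  induction k with
  | zero => simp
  | succ k ih =>
    have := (step k).1
    rw [Nat.succ_mul]
    omega

/-- An element almost stabilizing a long geodesic with a large displacement at an
interior point is not conjugate to a short element. -/
lemma lt_length_conj (H : HyperbolicLength L D) {γ : ℕ → G} {n : ℕ}
    (hγ : IsGeodesicFromOne L γ n) {v : G} {C : ℕ} (hv : L v ≤ C)
    (hvn : lenDist L (γ n) (v * γ n) ≤ C) {m : ℕ} (hm : 2 * C + D < m)
    (hmn : m + 2 * C + D < n) (hbig : 20 * D < lenDist L (γ m) (v * γ m)) (q : G) :
    6 * D < L (q⁻¹ * v * q) := by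
  by_contra! hq
  have h2 := H.two_mul_displacement_le hγ hv hvn hm hmn
  set z := γ m
  have hpow : ∀ k : ℕ, (z⁻¹ * v * z) ^ k = (z⁻¹ * q) * (q⁻¹ * v * q) ^ k * (z⁻¹ * q)⁻¹ := by
    intro k
    rw [← conj_pow]
    congr 1
    group
  have hle : ∀ k : ℕ, L ((q⁻¹ * v * q) ^ k) ≤ k * (6 * D) := by
    intro k
    induction k with
    | zero => simp [H.one]
    | succ k ih =>
      have := H.mul ((q⁻¹ * v * q) ^ k) (q⁻¹ * v * q)
      rw [pow_succ, Nat.succ_mul]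
      omega
  have e1 : lenDist L z (v * z) = L (z⁻¹ * v * z) := by simp [lenDist, mul_assoc]
  have e2 : lenDist L z (v * (v * z)) = L ((z⁻¹ * v * z) ^ 2) := by
    simp [lenDist, mul_assoc, pow_two]
  rw [e1, e2] at h2
  rw [e1] at hbig
  obtain ⟨k, hk⟩ : ∃ k, k = 2 * L (z⁻¹ * q) + 1 := ⟨_, rfl⟩
  have h3 := H.mul_le_length_pow h2 (t := 6 * D) (by omega) k
  rw [hpow k] at h3
  have h4 := H.mul ((z⁻¹ * q) * (q⁻¹ * v * q) ^ k) (z⁻¹ * q)⁻¹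
  have h5 := H.mul (z⁻¹ * q) ((q⁻¹ * v * q) ^ k)
  have h6 := hle k
  have h7 := H.inv (z⁻¹ * q)
  rw [Nat.mul_succ] at h3
  omega

/-- If `v` is not conjugate to a short element and moves both `1` and `z` by a bounded
distance, then `z` is close to the cyclic subgroup generated by `v`. -/
lemma exists_zpow_mul_length_le (H : HyperbolicLength L D) {v z : G} {C : ℕ}
    (hgood : ∀ q, 6 * D < L (q⁻¹ * v * q)) (hv : L v ≤ C) (hz : L (z⁻¹ * v * z) ≤ C) :
    ∃ j : ℤ, L (v ^ j * z) ≤ 2 * C + 2 * D + 2 := by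
  obtain ⟨_, ⟨j, rfl⟩, hmin⟩ := WellFounded.has_min (wellFounded_lt (α := ℕ))
    (Set.range fun j : ℤ => L (v ^ j * z)) (Set.range_nonempty _)
  have hmin' : ∀ i : ℤ, L (v ^ j * z) ≤ L (v ^ i * z) := fun i => not_lt.mp (hmin _ ⟨i, rfl⟩)
  refine ⟨j, ?_⟩
  by_contra! hlong
  obtain ⟨γ, h0, hn, hγ'⟩ := H.exists_geodesic (v ^ j * z)
  set n := L (v ^ j * z)
  have hγ : IsGeodesicFromOne L γ n := ⟨h0, hγ'⟩
  have hvn : lenDist L (γ n) (v * γ n) ≤ C := by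
    rw [hn, lenDist]
    convert hz using 2
    have : v * v ^ j = v ^ j * v := ((Commute.refl v).zpow_right j).eq
    rw [← mul_assoc v, this]
    group
  obtain ⟨m, hm⟩ : ∃ m, m = C + D + 1 := ⟨_, rfl⟩
  have hmn : m ≤ n := by omega
  have b := H.dist_translate_to_geodesic hγ hv hvn (i := m) (by omega) (by omega)
  have l1 := hγ.length_eq hmn
  have t1 := H.mul v (γ m)
  obtain ⟨a, ha⟩ : ∃ a, a = L (v * γ m) := ⟨_, rfl⟩
  rw [← ha] at b t1
  have han : a ≤ n := by omega
  have hd : 6 * D < lenDist L (γ m) (v * γ m) := by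
    simpa [lenDist, mul_assoc] using hgood (γ m)
  have t2 := H.dist_triangle (γ m) (γ a) (v * γ m)
  have c1 := H.dist_comm (γ a) (v * γ m)
  have s1 : n ≤ L (v⁻¹ * γ n) := by
    rw [hn]
    convert hmin' (j - 1) using 2
    rw [sub_eq_neg_add, zpow_add, zpow_neg_one, mul_assoc]
  have s2 : n ≤ L (v * γ n) := by
    rw [hn]
    convert hmin' (1 + j) using 2
    rw [zpow_add, zpow_one, mul_assoc]
  have la := hγ.length_eq han
  have ga := hγ.2 a n han le_rfl
  have gm := hγ.2 m n hmn le_rfl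
  have o1 := dist_one_left L (γ m)
  have o2 := dist_one_left L (γ a)
  have o3 := dist_one_left L (v * γ n)
  have o4 := dist_one_left L (v⁻¹ * γ n)
  have d1 := dist_mul_left L v (γ m) (γ n)
  have d2 := dist_mul_left L v⁻¹ (γ a) (γ n)
  have d3 := dist_mul_left L v⁻¹ (v * γ m) (γ a)
  rw [inv_mul_cancel_left] at d3
  have u1 := H.dist_triangle 1 (γ m) (v⁻¹ * γ n)
  have u2 := H.dist_triangle (γ m) (v⁻¹ * γ a) (v⁻¹ * γ n)
  have u3 := H.dist_triangle 1 (γ a) (v * γ n)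
  have u4 := H.dist_triangle (γ a) (v * γ m) (v * γ n)
  rcases le_total a m with ham | ham
  · have g := hγ.2 a m ham hmn
    have c2 := H.dist_comm (γ a) (γ m)
    omega
  · have g := hγ.2 m a ham han
    omega

/-- `A` is a set of conjugates of elements of bounded length, such that every geodesic from `1`
to a point of `A` stays close to `A`; then the first half of such a geodesic stays close to
a cyclic subgroup generated by a bounded element. -/
lemma exists_cyclic_near_geodesic (H : HyperbolicLength L D) {A : Set G} {C₀ ε : ℕ}
    (hA : ∀ x ∈ A, ∃ h b, L b ≤ C₀ ∧ x = h * b * h⁻¹)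
    (hqc : ∀ x ∈ A, ∀ p, L p + lenDist L p x = L x → ∃ q ∈ A, lenDist L p q ≤ ε) :
    ∃ C N K : ℕ, ∀ x ∈ A, ∀ k, K ≤ k → 2 * k + C ≤ L x → ∀ γ, γ (L x) = x →
      IsGeodesicFromOne L γ (L x) → ∃ v, L v ≤ C ∧
        ∀ i ≤ k, ∃ j : ℤ, L (v ^ j * γ i) ≤ N := by
  classical
  set B := (H.ball_finite (20 * D)).toFinset with hB
  set I := B.card * (2 * ε + 1)
  set R := 3 * C₀ + 2 * D + (I + 3 * ε)
  refine ⟨2 * R, 2 * (2 * R + D) + 2 * D + 2, 4 * (2 * R) + 2 * D + 3, ?_⟩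
  intro x hx k hk hkx γ hγx hγ
  have hpt : ∀ i ≤ I, ∃ q ∈ A, lenDist L (γ (2 * k + i)) q ≤ ε ∧
      lenDist L (γ k) (q * γ k) ≤ R := by
    intro i hi
    have l1 := hγ.length_eq (i := 2 * k + i) (by omega)
    have g1 := hγ.2 (2 * k + i) (L x) (by omega) le_rfl
    rw [hγx] at g1
    obtain ⟨q, hq, hpq⟩ := hqc x hx (γ (2 * k + i)) (by omega)
    refine ⟨q, hq, hpq, ?_⟩
    obtain ⟨h, b, hb, hqb⟩ := hA q hq
    have l2 := hγ.length_eq (i := k) (by omega)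
    have g2 := hγ.2 k (2 * k + i) (by omega) (by omega)
    have t1 := H.dist_triangle (γ k) (γ (2 * k + i)) q
    have t2 := H.dist_triangle 1 q (γ (2 * k + i))
    have c1 := H.dist_comm q (γ (2 * k + i))
    have o1 := dist_one_left L q
    have o2 := dist_one_left L (γ (2 * k + i))
    exact H.dist_conj_midpoint hqb hb (by omega) (by omega)
  choose! q hqA hq1 hq2 using hpt
  have hγk := hγ.mono (m := k) (by omega)
  obtain ⟨m, hm⟩ : ∃ m, m = 2 * (2 * R) + D + 1 := ⟨_, rfl⟩
  have hv : ∀ i ≤ I, L ((q 0)⁻¹ * q i) ≤ 2 * R ∧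
      lenDist L (γ k) ((q 0)⁻¹ * q i * γ k) ≤ 2 * R := by
    intro i hi
    constructor
    · have g := hγ.2 (2 * k + 0) (2 * k + i) (by omega) (by omega)
      have t1 := H.dist_triangle (q 0) (γ (2 * k + 0)) (q i)
      have t2 := H.dist_triangle (γ (2 * k + 0)) (γ (2 * k + i)) (q i)
      have c := H.dist_comm (q 0) (γ (2 * k + 0))
      have a1 := hq1 i hi
      have a2 := hq1 0 (Nat.zero_le _)
      change lenDist L (q 0) (q i) ≤ _
      omega
    · have e1 := dist_mul_left L (q 0) (γ k) ((q 0)⁻¹ * q i * γ k)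
      rw [mul_assoc (q 0)⁻¹, mul_inv_cancel_left] at e1
      have t1 := H.dist_triangle (q 0 * γ k) (γ k) (q i * γ k)
      have c := H.dist_comm (q 0 * γ k) (γ k)
      have a1 := hq2 i hi
      have a2 := hq2 0 (Nat.zero_le _)
      rw [mul_assoc (q 0)⁻¹]
      omega
  have hex : ∃ i ≤ I, 20 * D < lenDist L (γ m) ((q 0)⁻¹ * q i * γ m) := by
    by_contra! hall
    have hmul : ∀ s ∈ Finset.range (B.card + 1), s * (2 * ε + 1) ≤ I := fun s hs =>
      Nat.mul_le_mul_right _ (Nat.lt_succ_iff.mp (Finset.mem_range.mp hs))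
    obtain ⟨s, hs, t, ht, hst, heq⟩ := Finset.exists_ne_map_eq_of_card_lt_of_maps_to
      (s := Finset.range (B.card + 1)) (t := B) (by simp)
      (f := fun s => (γ m)⁻¹ * ((q 0)⁻¹ * q (s * (2 * ε + 1)) * γ m)) (by
        intro s hs
        simpa [hB, lenDist] using hall _ (hmul s hs))
    have hqq : q (s * (2 * ε + 1)) = q (t * (2 * ε + 1)) := by simpa using heq
    wlog hlt : s < t generalizing s t
    · exact this t ht s hs hst.symm heq.symm hqq.symm (by omega)
    have h1 := hmul s hs
    have h2 := hmul t ht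
    have h3 : s * (2 * ε + 1) + (2 * ε + 1) ≤ t * (2 * ε + 1) := by
      rw [← Nat.succ_mul]; exact Nat.mul_le_mul_right _ hlt
    have g := hγ.2 (2 * k + s * (2 * ε + 1)) (2 * k + t * (2 * ε + 1)) (by omega) (by omega)
    have t1 := H.dist_triangle (γ (2 * k + s * (2 * ε + 1))) (q (s * (2 * ε + 1)))
      (γ (2 * k + t * (2 * ε + 1)))
    have a1 := hq1 _ h1
    have a2 := hq1 _ h2
    rw [← hqq, H.dist_comm] at a2
    omega
  obtain ⟨i, hi, hbig⟩ := hex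
  obtain ⟨hv1, hv2⟩ := hv i hi
  have hgood := H.lt_length_conj hγk hv1 hv2 (m := m) (by omega) (by omega) hbig
  refine ⟨(q 0)⁻¹ * q i, hv1, fun i' hi' => ?_⟩
  have hz := H.dist_geodesic_translate hγk hv1 hv2 hi'
  rw [lenDist, ← mul_assoc] at hz
  exact H.exists_zpow_mul_length_le hgood (by omega) hz

/-- A geodesic translated by an element `p` which is shortest in its coset modulo a cyclic
subgroup close to the geodesic is almost radial. -/
lemma le_length_mul_geodesic (H : HyperbolicLength L D) {γ : ℕ → G} {k N : ℕ}
    (hγ : IsGeodesicFromOne L γ k) {v p : G}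
    (hv : ∀ i ≤ k, ∃ j : ℤ, L (v ^ j * γ i) ≤ N) (hp : ∀ j : ℤ, L p ≤ L (p * v ^ j))
    {i : ℕ} (hi : i ≤ k) : L p + i ≤ L (p * γ i) + 2 * N + 2 * D + 1 := by
  by_contra! hlt
  have t1 := H.mul p⁻¹ (p * γ i)
  have i1 := H.inv p
  rw [inv_mul_cancel_left, hγ.length_eq hi] at t1
  have l1 := hγ.length_eq hi
  have t2 := H.mul (p * γ i) (γ i)⁻¹
  rw [mul_inv_cancel_right, H.inv] at t2
  obtain ⟨T, hT⟩ : ∃ T, T = (L p + i - L (p * γ i)) / 2 := ⟨_, rfl⟩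
  have hTi : T ≤ i := by omega
  have g1 := hγ.2 T i hTi hi
  have l2 := hγ.length_eq (hTi.trans hi)
  have m1 := dist_mul_left L p (γ T) (γ i)
  have m2 : lenDist L p (p * γ T) = L (γ T) := by simp [lenDist]
  have m3 : lenDist L p (p * γ i) = L (γ i) := by simp [lenDist]
  have c1 := H.dist_comm (p * γ T) p
  have o1 := dist_one_left L p
  have o2 := dist_one_left L (p * γ T)
  have o3 := dist_one_left L (p * γ i)
  have f := H.four_point_dist 1 (p * γ T) p (p * γ i)
  obtain ⟨j, hj⟩ := hv T (hTi.trans hi)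
  have h1 := hp (-j)
  have h2 := H.mul (p * γ T) (v ^ j * γ T)⁻¹
  rw [H.inv] at h2
  have h3 : p * γ T * (v ^ j * γ T)⁻¹ = p * v ^ (-j) := by group
  rw [h3] at h2
  omega

/-- Finitely many cosets of each nontrivial short cyclic subgroup `⟨v ^ n⟩` cover `⟨v⟩`,
uniformly in bounded `v`. -/
lemma exists_finite_cosetReps_zpow (H : HyperbolicLength L D) (C N : ℕ) :
    ∃ E : Set G, E.Finite ∧ ∀ v, L v ≤ C → ∀ n : ℤ, v ^ n ≠ 1 → L (v ^ n) ≤ N →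
      ∀ m : ℤ, ∃ k : ℤ, ∃ e ∈ E, v ^ m = (v ^ n) ^ k * e := by
  have hone : ∀ v h : G, ∃ E : Set G, E.Finite ∧ ∀ n : ℤ, v ^ n = h → h ≠ 1 →
      ∀ m : ℤ, ∃ k : ℤ, ∃ e ∈ E, v ^ m = h ^ k * e := by
    intro v h
    by_cases hex : ∃ n : ℤ, v ^ n = h ∧ h ≠ 1
    · obtain ⟨n, rfl, hne⟩ := hex
      have hn : n ≠ 0 := by rintro rfl; simp at hne
      refine ⟨(fun r : ℤ => v ^ r) '' Set.Ico 0 |n|, (Set.finite_Ico _ _).image _, ?_⟩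
      intro _ _ _ m
      refine ⟨m / n, _, ⟨m % n, ⟨Int.emod_nonneg _ hn, Int.emod_lt_abs _ hn⟩, rfl⟩, ?_⟩
      simp only
      rw [← zpow_mul, ← zpow_add, Int.mul_ediv_add_emod]
    · push Not at hex
      exact ⟨∅, Set.finite_empty, fun n hn hne => absurd (hex n hn) hne⟩
  choose E hE hE' using hone
  refine ⟨⋃ v ∈ {v | L v ≤ C}, ⋃ h ∈ {h | L h ≤ N}, E v h,
    (H.ball_finite C).biUnion fun v _ => (H.ball_finite N).biUnion fun h _ => hE v h, ?_⟩
  intro v hv n hn1 hnN m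
  obtain ⟨k, e, he, hk⟩ := hE' v (v ^ n) n rfl hn1 m
  exact ⟨k, e, Set.mem_biUnion (show v ∈ {v | L v ≤ C} from hv)
    (Set.mem_biUnion (show v ^ n ∈ {h | L h ≤ N} from hnN) he), hk⟩

/-- If `A` is infinite, conjugation invariant, consists of conjugates of bounded elements and
is close to all geodesics from `1` to its points, then `G` is a finite union of cosets of cyclic
subgroups. -/
lemma exists_finite_cyclic_cover (H : HyperbolicLength L D) {A : Set G} {C₀ ε : ℕ}
    (hinf : A.Infinite) (hconj : ∀ x ∈ A, ∀ g, g * x * g⁻¹ ∈ A)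
    (hA : ∀ x ∈ A, ∃ h b, L b ≤ C₀ ∧ x = h * b * h⁻¹)
    (hqc : ∀ x ∈ A, ∀ p, L p + lenDist L p x = L x → ∃ q ∈ A, lenDist L p q ≤ ε) :
    ∃ W T : Set G, W.Finite ∧ T.Finite ∧
      ∀ g, ∃ w ∈ W, ∃ t ∈ T, ∃ l : ℤ, g = w ^ l * t := by
  classical
  obtain ⟨C, N, K, hCN⟩ := H.exists_cyclic_near_geodesic hA hqc
  obtain ⟨N₁, hN₁⟩ : ∃ N₁, N₁ = 3 * N + 4 * D + 1 := ⟨_, rfl⟩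
  set B := (H.ball_finite (N₁ + N)).toFinset with hB
  obtain ⟨I, hI⟩ : ∃ I, I = B.card * (2 * N + 1) := ⟨_, rfl⟩
  obtain ⟨E, hE, hE'⟩ := H.exists_finite_cosetReps_zpow C (2 * N + I)
  refine ⟨{w | L w ≤ C}, {t | L t ≤ N₁} * E, H.ball_finite C, (H.ball_finite N₁).mul hE, ?_⟩
  intro g
  obtain ⟨k, hk⟩ : ∃ k, k = K + L g + I + N + 2 * D + 1 := ⟨_, rfl⟩
  obtain ⟨k', hk'⟩ : ∃ k', k' = K + L g + I := ⟨_, rfl⟩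
  obtain ⟨x, hxA, hx⟩ : ∃ x ∈ A, 2 * k + 2 * k' + C + 2 * L g ≤ L x := by
    by_contra! hall
    exact hinf ((H.ball_finite (2 * k + 2 * k' + C + 2 * L g)).subset
      fun x hx => (hall x hx).le)
  obtain ⟨γ, hγ0, hγx, hγ'⟩ := H.exists_geodesic x
  have hγ : IsGeodesicFromOne L γ (L x) := ⟨hγ0, hγ'⟩
  obtain ⟨v, hvC, hv⟩ := hCN x hxA k (by omega) (by omega) γ hγx hγ
  have hγk := hγ.mono (m := k) (by omega)
  obtain ⟨_, ⟨j₀, rfl⟩, hmin⟩ := WellFounded.has_min (wellFounded_lt (α := ℕ))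
    (Set.range fun j : ℤ => L (g * v ^ j)) (Set.range_nonempty _)
  have hmin' : ∀ i : ℤ, L (g * v ^ j₀) ≤ L (g * v ^ i) := fun i => not_lt.mp (hmin _ ⟨i, rfl⟩)
  obtain ⟨p, hp⟩ : ∃ p, p = g * v ^ j₀ := ⟨_, rfl⟩
  have hpmin : ∀ j : ℤ, L p ≤ L (p * v ^ j) := by
    intro j
    rw [hp, mul_assoc, ← zpow_add]
    exact hmin' _
  have hpg : L p ≤ L g := by
    have := hmin' 0
    rwa [zpow_zero, mul_one, ← hp] at this
  obtain ⟨X, hX⟩ : ∃ X, X = p * x * p⁻¹ := ⟨_, rfl⟩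
  have hXA : X ∈ A := hX ▸ hconj x hxA p
  have hXlen : L x ≤ L X + 2 * L p := by
    have h1 := H.mul (p⁻¹ * X) p
    have h2 := H.mul p⁻¹ X
    have h3 : p⁻¹ * X * p = x := by rw [hX]; group
    rw [h3] at h1
    have := H.inv p
    omega
  obtain ⟨γ', hγ'0, hγ'X, hγ''⟩ := H.exists_geodesic X
  have hγX : IsGeodesicFromOne L γ' (L X) := ⟨hγ'0, hγ''⟩
  obtain ⟨w, hwC, hw⟩ := hCN X hXA k' (by omega) (by omega) γ' hγ'X hγX
  have near : ∀ i ≤ I, ∃ l : ℤ, L (w ^ l * (p * γ i)) ≤ N₁ := by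
    intro i hi
    have r1 := H.le_length_mul_geodesic hγk hv hpmin (le_refl k)
    have l1 := hγ.length_eq (i := i) (by omega)
    have g1 := hγ.2 i k (by omega) (by omega)
    have g2 := hγ.2 k (L x) (by omega) le_rfl
    have g3 := hγ.2 i (L x) (by omega) le_rfl
    rw [hγx] at g2 g3
    have t1 := H.mul p (γ i)
    have m0 : lenDist L X (p * x) = L p := by
      rw [hX]; simp [lenDist, mul_assoc]
    have m1 := dist_mul_left L p (γ i) (γ k)
    have m2 := dist_mul_left L p (γ i) x
    have m3 := dist_mul_left L p (γ k) x
    have c1 := H.dist_comm X (p * x)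
    have c2 := H.dist_comm X (p * γ k)
    have c3 := H.dist_comm X (p * γ i)
    have c4 := H.dist_comm (p * γ k) (p * γ i)
    have u1 := H.dist_triangle (p * γ k) (p * x) X
    have u2 := H.dist_triangle (p * γ i) X (p * x)
    have o1 := dist_one_left L X
    have o2 := dist_one_left L (p * γ k)
    have o3 := dist_one_left L (p * γ i)
    have f1 := H.four_point_dist 1 (p * γ k) X (p * γ i)
    have hqX : L (p * γ i) + lenDist L (p * γ i) X ≤ L X + 2 * N + 3 * D + 1 := by omega
    obtain ⟨r, hr⟩ : ∃ r, r = L (p * γ i) := ⟨_, rfl⟩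
    have l2 := hγX.length_eq (i := r) (by omega)
    have g4 := hγX.2 r (L X) (by omega) le_rfl
    rw [hγ'X] at g4
    have o4 := dist_one_left L (γ' r)
    have c5 := H.dist_comm (γ' r) 1
    have c6 := H.dist_comm (p * γ i) 1
    have f2 := H.four_point_dist (γ' r) (p * γ i) 1 X
    have hclose : lenDist L (γ' r) (p * γ i) ≤ 2 * N + 4 * D + 1 := by omega
    obtain ⟨l, hl⟩ := hw r (by omega)
    refine ⟨l, ?_⟩
    have h := H.mul (w ^ l * γ' r) ((γ' r)⁻¹ * (p * γ i))
    rw [mul_assoc, mul_inv_cancel_left] at h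
    change _ ≤ _ + lenDist L (γ' r) (p * γ i) at h
    omega
  have hv' : ∀ i ≤ I, ∃ j : ℤ, L (v ^ j * γ i) ≤ N := fun i hi => hv i (by omega)
  choose! l hl using near
  choose! j hj using hv'
  have hmul : ∀ s ∈ Finset.range (B.card + 1), s * (2 * N + 1) ≤ I := fun s hs =>
    hI ▸ Nat.mul_le_mul_right _ (Nat.lt_succ_iff.mp (Finset.mem_range.mp hs))
  obtain ⟨a, ha, b, hb, hab, heq⟩ := Finset.exists_ne_map_eq_of_card_lt_of_maps_to
    (s := Finset.range (B.card + 1)) (t := B) (by simp)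
    (f := fun s => w ^ l (s * (2 * N + 1)) * p * v ^ (-j (s * (2 * N + 1)))) (by
      intro s hs
      have h1 := hl _ (hmul s hs)
      have h2 := hj _ (hmul s hs)
      set i := s * (2 * N + 1)
      have h3 := H.mul (w ^ l i * (p * γ i)) (v ^ j i * γ i)⁻¹
      rw [H.inv] at h3
      have h4 : w ^ l i * (p * γ i) * (v ^ j i * γ i)⁻¹ = w ^ l i * p * v ^ (-j i) := by group
      rw [h4] at h3
      rw [hB, Set.Finite.coe_toFinset]
      change L (w ^ l i * p * v ^ (-j i)) ≤ N₁ + N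
      omega)
  have hlt' : a < b ∨ b < a := lt_or_gt_of_ne hab
  clear hab
  wlog hlt : a < b generalizing a b
  · exact this b hb a ha heq.symm hlt'.symm (by omega)
  have ha' := hmul a ha
  have hb' := hmul b hb
  have hab : a * (2 * N + 1) + (2 * N + 1) ≤ b * (2 * N + 1) := by
    rw [← Nat.succ_mul]; exact Nat.mul_le_mul_right _ hlt
  generalize a * (2 * N + 1) = a at *
  generalize b * (2 * N + 1) = b at *
  have gab := hγ.2 a b (by omega) (by omega)
  have la := hj a ha'
  have lb := hj b hb'
  have hcomm : v ^ (j b - j a) = (v ^ j b * γ b) * ((γ a)⁻¹ * γ b)⁻¹ * (v ^ j a * γ a)⁻¹ := by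
    group
  have hupper : L (v ^ (j b - j a)) ≤ 2 * N + I := by
    have h1 := H.mul ((v ^ j b * γ b) * ((γ a)⁻¹ * γ b)⁻¹) (v ^ j a * γ a)⁻¹
    have h2 := H.mul (v ^ j b * γ b) ((γ a)⁻¹ * γ b)⁻¹
    rw [H.inv] at h1 h2
    rw [hcomm]
    change _ ≤ _ + lenDist L (γ a) (γ b) at h2
    omega
  have hne : v ^ (j b - j a) ≠ 1 := by
    intro h1
    have h2 : (γ a)⁻¹ * γ b = (v ^ j a * γ a)⁻¹ * (v ^ j b * γ b) := by
      have : v ^ j b = v ^ j a := by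
        rw [zpow_sub, mul_inv_eq_one] at h1
        exact h1
      rw [this]; group
    have h3 := H.mul (v ^ j a * γ a)⁻¹ (v ^ j b * γ b)
    rw [H.inv, ← h2] at h3
    change lenDist L (γ a) (γ b) ≤ _ at h3
    omega
  obtain ⟨c, e, he, hce⟩ := hE' v hvC _ hne hupper (-j₀)
  have hpv : p * v ^ (j b - j a) * p⁻¹ = w ^ (l b - l a) := by
    have h1 : w ^ (l b) * p * v ^ (-j b) = w ^ (l a) * p * v ^ (-j a) := heq.symm
    have h2 : p = w ^ (-l b) * (w ^ (l a) * p * v ^ (-j a)) * v ^ (j b) := by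
      rw [← h1]; group
    have h3 : w ^ (l b - l a) * p = p * v ^ (j b - j a) := by
      conv_lhs => rw [h2]
      group
    rw [← h3, mul_inv_cancel_right]
  have hl0 := hl 0 (Nat.zero_le _)
  rw [hγ0, mul_one] at hl0
  refine ⟨w, hwC, w ^ l 0 * p * e, Set.mul_mem_mul hl0 he, (l b - l a) * c - l 0, ?_⟩
  have hg : g = p * v ^ (-j₀) := by rw [hp]; group
  calc g = (p * v ^ (j b - j a) * p⁻¹) ^ c * p * e := by
        rw [conj_zpow, hg, hce]; group
    _ = w ^ ((l b - l a) * c - l 0) * (w ^ l 0 * p * e) := by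
        rw [hpv, ← zpow_mul, zpow_sub]; group

end HyperbolicLength

end HyperbolicLength

section WordLength

variable {G : Type*} [Group G] {S : Set G}

lemma wordLength_prod_le (l : List G) (hl : ∀ s ∈ l, s ∈ S) : wordLength S l.prod ≤ l.length :=
  Nat.sInf_le ⟨l, hl, rfl, rfl⟩

lemma exists_word_length_eq (hSsym : ∀ s ∈ S, s⁻¹ ∈ S) (hSgen : Subgroup.closure S = ⊤) (g : G) :
    ∃ l : List G, (∀ s ∈ l, s ∈ S) ∧ l.prod = g ∧ l.length = wordLength S g := by
  refine Nat.sInf_mem (s := {n | ∃ l : List G, (∀ s ∈ l, s ∈ S) ∧ l.prod = g ∧ l.length = n}) ?_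
  obtain ⟨l, hl, hg⟩ := Submonoid.exists_list_of_mem_closure (s := S ∪ S⁻¹) (x := g) (by
    rw [← Subgroup.closure_toSubmonoid, hSgen]
    trivial)
  refine ⟨l.length, l, fun s hs => ?_, hg, rfl⟩
  rcases hl s hs with h | h
  · exact h
  · simpa using hSsym _ h

lemma wordLength_one : wordLength S 1 = 0 := by
  simpa using wordLength_prod_le (S := S) [] (by simp)

lemma wordLength_mul_le (hSsym : ∀ s ∈ S, s⁻¹ ∈ S) (hSgen : Subgroup.closure S = ⊤) (g h : G) :
    wordLength S (g * h) ≤ wordLength S g + wordLength S h := by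
  obtain ⟨l, hl, hlg, hln⟩ := exists_word_length_eq hSsym hSgen g
  obtain ⟨m, hm, hmh, hmn⟩ := exists_word_length_eq hSsym hSgen h
  have := wordLength_prod_le (S := S) (l ++ m) (by
    intro s hs
    rcases List.mem_append.mp hs with h | h
    exacts [hl s h, hm s h])
  rwa [List.prod_append, hlg, hmh, List.length_append, hln, hmn] at this

lemma wordLength_inv_le (hSsym : ∀ s ∈ S, s⁻¹ ∈ S) (hSgen : Subgroup.closure S = ⊤) (g : G) :
    wordLength S g⁻¹ ≤ wordLength S g := by
  obtain ⟨l, hl, hlg, hln⟩ := exists_word_length_eq hSsym hSgen g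
  have := wordLength_prod_le (S := S) (l.map fun x => x⁻¹).reverse (by
    intro s hs
    obtain ⟨t, ht, rfl⟩ := List.mem_map.mp (List.mem_reverse.mp hs)
    exact hSsym t (hl t ht))
  rwa [← List.prod_inv_reverse, List.length_reverse, List.length_map, hlg, hln] at this

lemma finite_wordLength_le (hSfin : S.Finite) (hSsym : ∀ s ∈ S, s⁻¹ ∈ S)
    (hSgen : Subgroup.closure S = ⊤) (n : ℕ) : {g | wordLength S g ≤ n}.Finite := by
  have hword : ∀ n : ℕ,
      {g | ∃ l : List G, (∀ s ∈ l, s ∈ S) ∧ l.prod = g ∧ l.length ≤ n}.Finite := by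
    intro n
    induction n with
    | zero =>
      refine (Set.finite_singleton (1 : G)).subset ?_
      rintro g ⟨l, -, rfl, hn⟩
      simp [List.length_eq_zero_iff.mp (Nat.le_zero.mp hn)]
    | succ n ih =>
      refine ((hSfin.mul ih).union (Set.finite_singleton 1)).subset ?_
      rintro g ⟨l, hl, rfl, hn⟩
      cases l with
      | nil => right; simp
      | cons a l =>
        left
        rw [List.prod_cons]
        exact Set.mul_mem_mul (hl a (by simp))
          ⟨l, fun s hs => hl s (by simp [hs]), rfl, by simpa using hn⟩
  refine (hword n).subset fun g hg => ?_
  obtain ⟨l, hl, hlg, hln⟩ := exists_word_length_eq hSsym hSgen g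
  exact ⟨l, hl, hlg, hln.trans_le hg⟩

lemma exists_wordLength_geodesic (hSsym : ∀ s ∈ S, s⁻¹ ∈ S) (hSgen : Subgroup.closure S = ⊤)
    (x : G) : ∃ γ : ℕ → G, γ 0 = 1 ∧ γ (wordLength S x) = x ∧
      ∀ i j, i ≤ j → j ≤ wordLength S x → wordLength S ((γ i)⁻¹ * γ j) + i = j := by
  obtain ⟨l, hl, hlx, hln⟩ := exists_word_length_eq hSsym hSgen x
  have hle : ∀ i j, i ≤ j → j ≤ l.length →
      wordLength S ((l.take i).prod⁻¹ * (l.take j).prod) + i ≤ j := by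
    intro i j hij hj
    have hsplit : (l.take j).prod = (l.take i).prod * ((l.take j).drop i).prod := by
      rw [← List.prod_append]
      congr 1
      conv_lhs => rw [← List.take_append_drop i (l.take j), List.take_take, min_eq_left hij]
    have h := wordLength_prod_le (S := S) ((l.take j).drop i)
      fun s hs => hl s (List.mem_of_mem_take (List.mem_of_mem_drop hs))
    rw [List.length_drop, List.length_take] at h
    rw [hsplit, inv_mul_cancel_left]
    omega
  refine ⟨fun i => (l.take i).prod, by simp, by simp [← hln, hlx], ?_⟩
  intro i j hij hj
  have h1 := hle 0 i (Nat.zero_le _) (by omega)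
  have h2 := hle i j hij (by omega)
  have h3 := hle j l.length (by omega) le_rfl
  rw [List.take_zero, List.prod_nil, inv_one, one_mul] at h1
  rw [List.take_length, hlx] at h3
  have t1 := wordLength_mul_le hSsym hSgen (l.take i).prod ((l.take i).prod⁻¹ * (l.take j).prod)
  have t2 := wordLength_mul_le hSsym hSgen (l.take j).prod ((l.take j).prod⁻¹ * x)
  rw [mul_inv_cancel_left] at t1 t2
  dsimp only
  omega

lemma hyperbolicLength_wordLength (hSfin : S.Finite) (hSsym : ∀ s ∈ S, s⁻¹ ∈ S)
    (hSgen : Subgroup.closure S = ⊤) {δ : ℝ} (hhyp : IsHyperbolicWith S δ) :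
    HyperbolicLength (wordLength S) ⌈2 * δ⌉₊ where
  one := wordLength_one
  inv g := le_antisymm (wordLength_inv_le hSsym hSgen g)
    (by simpa using wordLength_inv_le hSsym hSgen g⁻¹)
  mul := wordLength_mul_le hSsym hSgen
  ball_finite := finite_wordLength_le hSfin hSsym hSgen
  exists_geodesic := exists_wordLength_geodesic hSsym hSgen
  four_point x y z w := by
    have h := hhyp.1 x y z w
    have hD : 2 * δ ≤ (⌈2 * δ⌉₊ : ℝ) := Nat.le_ceil _
    simp only [gromovProd, wdist, ge_iff_le, sub_le_iff_le_add, min_le_iff] at h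
    rcases h with h | h
    · left
      have : (wordLength S (x⁻¹ * y) + wordLength S (z⁻¹ * w) : ℝ) ≤
          wordLength S (x⁻¹ * z) + wordLength S (y⁻¹ * w) + ⌈2 * δ⌉₊ := by linarith
      exact_mod_cast this
    · right
      have : (wordLength S (x⁻¹ * y) + wordLength S (z⁻¹ * w) : ℝ) ≤
          wordLength S (x⁻¹ * w) + wordLength S (y⁻¹ * z) + ⌈2 * δ⌉₊ := by linarith
      exact_mod_cast this

/-- Geodesics from `1` to the points of a quasiconvex set stay close to the set. -/
lemma IsEpsQuasiconvex.exists_dist_le {D : ℕ} (H : HyperbolicLength (wordLength S) D) {A : Set G}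
    {ε : ℝ} (hA : IsEpsQuasiconvex S ε A) {x₀ : G} (hx₀ : x₀ ∈ A) :
    ∀ x ∈ A, ∀ p, wordLength S p + lenDist (wordLength S) p x = wordLength S x →
      ∃ q ∈ A, lenDist (wordLength S) p q ≤ 2 * wordLength S x₀ + D + ⌈ε⌉₊ := by
  intro x hx p hp
  obtain ⟨L, hL⟩ : ∃ L, L = wordLength S := ⟨_, rfl⟩
  have o1 := HyperbolicLength.dist_one_left L p
  have o2 := HyperbolicLength.dist_one_left L x₀
  have o3 := HyperbolicLength.dist_one_left L x
  have c1 := H.dist_comm p 1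
  have c2 := H.dist_comm x₀ 1
  have c3 := H.dist_comm x₀ x
  have t1 := H.dist_triangle p 1 x₀
  have t2 := H.dist_triangle 1 x₀ x
  rw [← hL] at H hp c1 c2 c3 t1 t2 ⊢
  obtain ⟨γ, h0, hn, hγ⟩ := H.exists_geodesic (x₀⁻¹ * x)
  change γ (lenDist L x₀ x) = _ at hn
  change ∀ i j, i ≤ j → j ≤ lenDist L x₀ x → lenDist L (γ i) (γ j) + i = j at hγ
  rcases le_total (lenDist L p x) (lenDist L x₀ x) with hle | hle
  · obtain ⟨i, hi⟩ : ∃ i, i = lenDist L x₀ x - lenDist L p x := ⟨_, rfl⟩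
    obtain ⟨z, hz⟩ : ∃ z, z = x₀ * γ i := ⟨_, rfl⟩
    have d1 : lenDist L x₀ z = i := by
      have h1 := HyperbolicLength.dist_mul_left L x₀ (γ 0) (γ i)
      have h2 := hγ 0 i (Nat.zero_le _) (by omega)
      rw [h0, mul_one, ← hz, ← h0] at h1
      omega
    have d2 : lenDist L z x = lenDist L p x := by
      have h1 := HyperbolicLength.dist_mul_left L x₀ (γ i) (γ (lenDist L x₀ x))
      have h2 := hγ i (lenDist L x₀ x) (by omega) le_rfl
      rw [hn, mul_inv_cancel_left, ← hz, ← hn] at h1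
      omega
    obtain ⟨q, hq, hzq⟩ := hA x₀ hx₀ x hx z (by
      have : lenDist L x₀ z + lenDist L z x = lenDist L x₀ x := by omega
      rw [hL] at this
      simp only [LiesBetween, wdist]
      exact_mod_cast this)
    have hzq' : lenDist L z q ≤ ⌈ε⌉₊ := by
      rw [hL]
      have h := hzq.trans (Nat.le_ceil ε)
      unfold wdist at h
      exact_mod_cast h
    have f := H.four_point_dist p z x₀ x
    have c4 := H.dist_comm z x₀
    have t3 := H.dist_triangle p z q
    exact ⟨q, hq, by omega⟩
  · exact ⟨x₀, hx₀, by omega⟩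

end WordLength

/-- A group covered by finitely many right cosets of cyclic subgroups has a cyclic subgroup
of finite index. -/
lemma exists_zpowers_index_ne_zero_of_cover {G : Type*} [Group G] {W T : Set G} (hW : W.Finite)
    (hT : T.Finite) (hcover : ∀ g : G, ∃ w ∈ W, ∃ t ∈ T, ∃ l : ℤ, g = w ^ l * t) :
    ∃ w : G, (Subgroup.zpowers w).index ≠ 0 := by
  obtain ⟨k, -, hk⟩ := Subgroup.exists_finiteIndex_of_leftCoset_cover
    (s := (hW.prod hT).toFinset) (H := fun i : G × G => Subgroup.zpowers i.1)
    (g := fun i => i.2⁻¹) (by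
      refine Set.eq_univ_of_forall fun g => ?_
      obtain ⟨w, hw, t, ht, l, hl⟩ := hcover g⁻¹
      refine Set.mem_biUnion (x := (w, t)) (by simp [hw, ht]) ?_
      refine ⟨w ^ (-l), ⟨-l, rfl⟩, ?_⟩
      change t⁻¹ * w ^ (-l) = g
      rw [← inv_inv g, hl, mul_inv_rev, zpow_neg])
  exact ⟨k.1, hk.index_ne_zero⟩

/-- Let `G` be a non-elementary `δ`-hyperbolic group (no cyclic subgroup of `G` has finite
index) and let `A = a₁^G ∪ ⋯ ∪ a_s^G` be a finite union of conjugacy classes.  If `A` is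
infinite, then `A` is not quasiconvex. -/
theorem infinite_union_of_conjugacy_classes_not_quasiconvex
    {G : Type*} [Group G] (S : Set G) (hSfin : S.Finite)
    (hSsym : ∀ s ∈ S, s⁻¹ ∈ S) (hSgen : Subgroup.closure S = ⊤)
    (δ : ℝ) (hδ : 0 ≤ δ) (hhyp : IsHyperbolicWith S δ)
    (hne : ∀ g : G, (Subgroup.zpowers g).index = 0)
    (s : ℕ) (a : Fin s → G)
    (hinf : (⋃ j, {x | ∃ g : G, x = g * a j * g⁻¹} : Set G).Infinite) :
    ¬ IsQuasiconvex S (⋃ j, {x | ∃ g : G, x = g * a j * g⁻¹}) := by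
  rintro ⟨ε, -, hqc⟩
  have H := hyperbolicLength_wordLength hSfin hSsym hSgen hhyp
  obtain ⟨x₀, hx₀⟩ := hinf.nonempty
  obtain ⟨W, T, hW, hT, hcover⟩ := H.exists_finite_cyclic_cover
    (C₀ := ∑ j, wordLength S (a j)) hinf (by
      intro x hx g
      obtain ⟨j, h, rfl⟩ := Set.mem_iUnion.mp hx
      exact Set.mem_iUnion.mpr ⟨j, g * h, by group⟩) (by
      intro x hx
      obtain ⟨j, h, rfl⟩ := Set.mem_iUnion.mp hx
      exact ⟨h, a j, Finset.single_le_sum (f := fun j => wordLength S (a j))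
        (fun _ _ => Nat.zero_le _) (Finset.mem_univ j), rfl⟩)
    (hqc.exists_dist_le H hx₀)
  obtain ⟨w, hw⟩ := exists_zpowers_index_ne_zero_of_cover hW hT hcover
  exact hw (hne w)
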